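/- Let D be a t-discrete PvMD, i.e., a PvMD with no nonzero branched t-idempotent prime t-ideals. Then a nonzero t-ideal I of D is t-idempotent if and only if I is a radical ideal and every prime ideal of D minimal over I is unbranched. -/

import Mathlib

/-! Statement 14: Let D be a t-discrete PvMD (no nonzero branched t-idempotent prime t-ideals). Then a nonzero t-ideal I is t-idempotent iff I is radical and every prime minimal over I is unbranched. -/

noncomputable section

/-- The image of an ideal of `D` in the fraction field of `D`, as a `D`-submodule. -/
def coeI (D : Type*) [CommRing D] [IsDomain D] (I : Ideal D) :
    Submodule D (FractionRing D) :=
  Submodule.map (Algebra.linearMap D (FractionRing D)) I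

/-- The `v`-operation on `D`-submodules of the fraction field `K`:
`E^v = (E⁻¹)⁻¹`, where `E⁻¹ = (D : E) = {x ∈ K : xE ⊆ D}`. -/
def vSub (D : Type*) [CommRing D] [IsDomain D] (E : Submodule D (FractionRing D)) :
    Submodule D (FractionRing D) :=
  1 / (1 / E)

/-- The `t`-operation: `E^t = ⋃ {F^v : F` a nonzero finitely generated submodule `⊆ E}`,
as a subset of the fraction field. -/
def tSet (D : Type*) [CommRing D] [IsDomain D] (E : Submodule D (FractionRing D)) :
    Set (FractionRing D) :=
  ⋃ F ∈ {F : Submodule D (FractionRing D) | F.FG ∧ F ≠ ⊥ ∧ F ≤ E},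
    (vSub D F : Set (FractionRing D))

/-- An integral ideal `I` of `D` is a `t`-ideal if `I^t = I`. -/
def IsTIdeal (D : Type*) [CommRing D] [IsDomain D] (I : Ideal D) : Prop :=
  tSet D (coeI D I) = (coeI D I : Set (FractionRing D))

/-- A nonzero ideal `I` of `D` is `t`-idempotent if `(I²)^t = I^t`. -/
def TIdem (D : Type*) [CommRing D] [IsDomain D] (I : Ideal D) : Prop :=
  tSet D (coeI D (I * I)) = tSet D (coeI D I)

/-- `D` is a Prüfer `v`-multiplication domain: `(F·F⁻¹)^t = D` for every nonzero
finitely generated ideal `F` of `D`. -/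
def IsPvMD (D : Type*) [CommRing D] [IsDomain D] : Prop :=
  ∀ F : Ideal D, F ≠ ⊥ → F.FG →
    tSet D (coeI D F * (1 / coeI D F)) =
      ((1 : Submodule D (FractionRing D)) : Set (FractionRing D))

/-- A `t`-maximal ideal: an ideal maximal among proper integral `t`-ideals. -/
def IsTMax (D : Type*) [CommRing D] [IsDomain D] (M : Ideal D) : Prop :=
  M ≠ ⊤ ∧ IsTIdeal D M ∧ ∀ J : Ideal D, J ≠ ⊤ → IsTIdeal D J → M ≤ J → J = M

/-- The localization `D_P` of `D` at a prime `P`, viewed as a subset of the fraction field: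
the set of fractions `a / s` with `s ∉ P`. -/
def locSet (D : Type*) [CommRing D] [IsDomain D] (P : Ideal D) : Set (FractionRing D) :=
  {x | ∃ a s : D, s ∉ P ∧ x * algebraMap D (FractionRing D) s = algebraMap D (FractionRing D) a}

/-- A prime `t`-ideal `P` is `t`-sharp if `⋂ {D_M : M t-maximal, M ⊉ P} ⊄ D_P`. -/
def IsTSharp (D : Type*) [CommRing D] [IsDomain D] (P : Ideal D) : Prop :=
  ¬ (⋂ M ∈ {M : Ideal D | IsTMax D M ∧ ¬ P ≤ M}, locSet D M) ⊆ locSet D P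

/-- A prime ideal `P` of `D` is branched if there is a `P`-primary ideal distinct from `P`. -/
def IsBranched (D : Type*) [CommRing D] [IsDomain D] (P : Ideal D) : Prop :=
  ∃ Q : Ideal D, Q.IsPrimary ∧ Q.radical = P ∧ Q ≠ P

/-- `D` has finite `t`-character: every nonzero element lies in only finitely many
`t`-maximal ideals. -/
def FiniteTCharacter (D : Type*) [CommRing D] [IsDomain D] : Prop :=
  ∀ a : D, a ≠ 0 → {M : Ideal D | IsTMax D M ∧ a ∈ M}.Finite

/-- A nonzero ideal `I` of `D` is divisorial if `(I⁻¹)⁻¹ = I`. -/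
def IsDivisorial (D : Type*) [CommRing D] [IsDomain D] (I : Ideal D) : Prop :=
  vSub D (coeI D I) = coeI D I


/-- `x` lies in the `v`-closure of the integral ideal `F`, expressed through divisibility. -/
def InVClosure {D : Type*} [CommRing D] (F : Ideal D) (x : D) : Prop :=
  ∀ b c : D, c ≠ 0 → (∀ f ∈ F, c ∣ b * f) → c ∣ b * x

/-- `x` lies in the `t`-closure of the integral ideal `J`. -/
def InTClosure {D : Type*} [CommRing D] (J : Ideal D) (x : D) : Prop :=
  ∃ F : Ideal D, F.FG ∧ F ≠ ⊥ ∧ F ≤ J ∧ InVClosure F x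

/-- A prime ideal whose `t`-closure is proper. -/
def IsTProperPrime {D : Type*} [CommRing D] (P : Ideal D) : Prop :=
  P.IsPrime ∧ ¬ InTClosure P 1

section TClosure

variable {D : Type*} [CommRing D] [IsDomain D]

theorem mem_coeI {J : Ideal D} {z : FractionRing D} :
    z ∈ coeI D J ↔ ∃ x ∈ J, algebraMap D (FractionRing D) x = z := by
  simp [coeI, Submodule.mem_map]

theorem algebraMap_mem_coeI {J : Ideal D} {x : D} :
    algebraMap D (FractionRing D) x ∈ coeI D J ↔ x ∈ J := by
  rw [mem_coeI]
  constructor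
  · rintro ⟨y, hy, h⟩
    rwa [← IsFractionRing.injective D (FractionRing D) h]
  · exact fun h => ⟨x, h, rfl⟩

theorem coeI_le_one (J : Ideal D) : coeI D J ≤ 1 := by
  intro z hz
  obtain ⟨x, -, rfl⟩ := mem_coeI.1 hz
  exact Submodule.mem_one.2 ⟨x, rfl⟩

theorem coeI_mono {F J : Ideal D} : coeI D F ≤ coeI D J ↔ F ≤ J := by
  constructor
  · intro h x hx
    exact algebraMap_mem_coeI.1 (h (algebraMap_mem_coeI.2 hx))
  · exact fun h => Submodule.map_mono h

theorem coeI_eq_bot {F : Ideal D} : coeI D F = ⊥ ↔ F = ⊥ := by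
  rw [← (Submodule.map_injective_of_injective (f := Algebra.linearMap D (FractionRing D))
    (IsFractionRing.injective D (FractionRing D))).eq_iff (b := ⊥), Submodule.map_bot, coeI]

theorem exists_coeI_eq {G : Submodule D (FractionRing D)} (hG : G ≤ 1) (hfg : G.FG) :
    ∃ F : Ideal D, F.FG ∧ coeI D F = G := by
  have h : coeI D (G.comap (Algebra.linearMap D (FractionRing D))) = G := by
    rw [coeI, Submodule.map_comap_eq, inf_eq_right]
    intro z hz
    obtain ⟨x, rfl⟩ := Submodule.mem_one.1 (hG hz)
    exact ⟨x, rfl⟩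
  refine ⟨_, ?_, h⟩
  apply Submodule.fg_of_fg_map_injective (Algebra.linearMap D (FractionRing D))
    (IsFractionRing.injective D (FractionRing D))
  rw [coeI] at h
  rwa [h]

theorem div_mem_one_div_coeI {F : Ideal D} {b c : D} (hc : c ≠ 0) :
    algebraMap D (FractionRing D) b / algebraMap D (FractionRing D) c ∈ 1 / coeI D F ↔
      ∀ f ∈ F, c ∣ b * f := by
  have hc' : algebraMap D (FractionRing D) c ≠ 0 := by
    simpa using hc
  rw [Submodule.mem_div_iff_forall_mul_mem]
  constructor
  · intro h f hf
    obtain ⟨d, hd⟩ := Submodule.mem_one.1 (h _ (algebraMap_mem_coeI.2 hf))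
    refine ⟨d, IsFractionRing.injective D (FractionRing D) ?_⟩
    rw [map_mul, map_mul, hd]
    field_simp
  · intro h y hy
    obtain ⟨f, hf, rfl⟩ := mem_coeI.1 hy
    obtain ⟨d, hd⟩ := h f hf
    refine Submodule.mem_one.2 ⟨d, ?_⟩
    rw [div_mul_eq_mul_div, ← map_mul, hd, map_mul]
    field_simp

theorem algebraMap_mem_vSub {F : Ideal D} {x : D} :
    algebraMap D (FractionRing D) x ∈ vSub D (coeI D F) ↔ InVClosure F x := by
  rw [vSub, Submodule.mem_div_iff_forall_mul_mem]
  constructor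
  · intro h b c hc hF
    have hc' : algebraMap D (FractionRing D) c ≠ 0 := by
      simpa using hc
    obtain ⟨d, hd⟩ := Submodule.mem_one.1 (h _ ((div_mem_one_div_coeI hc).2 hF))
    refine ⟨d, IsFractionRing.injective D (FractionRing D) ?_⟩
    rw [map_mul, map_mul, hd]
    field_simp
  · intro h y hy
    obtain ⟨b, c, hc, rfl⟩ := IsFractionRing.div_surjective (A := D) y
    have hc0 : c ≠ 0 := nonZeroDivisors.ne_zero hc
    have hc' : algebraMap D (FractionRing D) c ≠ 0 := by
      simpa using hc0
    obtain ⟨d, hd⟩ := h b c hc0 ((div_mem_one_div_coeI hc0).1 hy)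
    refine Submodule.mem_one.2 ⟨d, ?_⟩
    rw [mul_div_assoc', mul_comm, ← map_mul, hd, map_mul]
    field_simp

theorem mem_tSet_of_le_one {E : Submodule D (FractionRing D)} (hE : E ≤ 1)
    {z : FractionRing D} :
    z ∈ tSet D E ↔ ∃ F : Ideal D, F.FG ∧ F ≠ ⊥ ∧ coeI D F ≤ E ∧ z ∈ vSub D (coeI D F) := by
  simp only [tSet, Set.mem_iUnion, Set.mem_ofPred_eq, SetLike.mem_coe, exists_prop]
  constructor
  · rintro ⟨G, ⟨hfg, hbot, hle⟩, hz⟩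
    obtain ⟨F, hF, rfl⟩ := exists_coeI_eq (hle.trans hE) hfg
    exact ⟨F, hF, fun h => hbot (coeI_eq_bot.2 h), hle, hz⟩
  · rintro ⟨F, hF, hbot, hle, hz⟩
    exact ⟨coeI D F, ⟨Submodule.FG.map _ hF, fun h => hbot (coeI_eq_bot.1 h), hle⟩, hz⟩

theorem algebraMap_mem_tSet {J : Ideal D} {x : D} :
    algebraMap D (FractionRing D) x ∈ tSet D (coeI D J) ↔ InTClosure J x := by
  rw [mem_tSet_of_le_one (coeI_le_one J)]
  simp only [coeI_mono, algebraMap_mem_vSub, InTClosure]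

theorem tSet_coeI_subset_range {J : Ideal D} {z : FractionRing D}
    (hz : z ∈ tSet D (coeI D J)) : ∃ x : D, algebraMap D (FractionRing D) x = z := by
  obtain ⟨F, -, -, -, h⟩ := (mem_tSet_of_le_one (coeI_le_one J)).1 hz
  rw [vSub, Submodule.mem_div_iff_forall_mul_mem] at h
  have h1 : (1 : FractionRing D) ∈ 1 / coeI D F := by
    rw [Submodule.mem_div_iff_forall_mul_mem]
    intro y hy
    rw [one_mul]
    exact coeI_le_one F hy
  simpa [Submodule.mem_one] using h 1 h1

omit [IsDomain D] in
theorem inTClosure_mono {J J' : Ideal D} (h : J ≤ J') {x : D} (hx : InTClosure J x) :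
    InTClosure J' x := by
  obtain ⟨F, h1, h2, h3, h4⟩ := hx
  exact ⟨F, h1, h2, h3.trans h, h4⟩

omit [IsDomain D] in
theorem inTClosure_of_mem {J : Ideal D} (hJ : J ≠ ⊥) {x : D} (hx : x ∈ J) :
    InTClosure J x := by
  by_cases h0 : x = 0
  · obtain ⟨y, hy, hy0⟩ := Submodule.exists_mem_ne_zero_of_ne_bot hJ
    refine ⟨Ideal.span {y}, ⟨{y}, by simp⟩, by simpa using hy0,
      (Ideal.span_singleton_le_iff_mem J).2 hy, fun b c _ _ => ?_⟩
    simp [h0]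
  · exact ⟨Ideal.span {x}, ⟨{x}, by simp⟩, by simpa using h0,
      (Ideal.span_singleton_le_iff_mem J).2 hx,
      fun b c _ h => h x (Ideal.mem_span_singleton_self x)⟩

theorem isTIdeal_iff {J : Ideal D} (hJ : J ≠ ⊥) :
    IsTIdeal D J ↔ ∀ x, InTClosure J x → x ∈ J := by
  constructor
  · intro h x hx
    rw [← algebraMap_mem_tSet, h] at hx
    exact algebraMap_mem_coeI.1 hx
  · intro h
    ext z
    constructor
    · intro hz
      obtain ⟨x, rfl⟩ := tSet_coeI_subset_range hz
      exact algebraMap_mem_coeI.2 (h x (algebraMap_mem_tSet.1 hz))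
    · intro hz
      obtain ⟨x, hx, rfl⟩ := mem_coeI.1 hz
      exact algebraMap_mem_tSet.2 (inTClosure_of_mem hJ hx)

theorem tIdem_iff {J : Ideal D} (hJ : J ≠ ⊥) (hJt : IsTIdeal D J) :
    TIdem D J ↔ ∀ x ∈ J, InTClosure (J * J) x := by
  constructor
  · intro h x hx
    rw [← algebraMap_mem_tSet, h]
    exact algebraMap_mem_tSet.2 (inTClosure_of_mem hJ hx)
  · intro h
    ext z
    constructor
    · intro hz
      obtain ⟨x, rfl⟩ := tSet_coeI_subset_range hz
      exact algebraMap_mem_tSet.2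
        (inTClosure_mono Ideal.mul_le_left (algebraMap_mem_tSet.1 hz))
    · intro hz
      obtain ⟨x, rfl⟩ := tSet_coeI_subset_range hz
      exact algebraMap_mem_tSet.2 (h x ((isTIdeal_iff hJ).1 hJt x (algebraMap_mem_tSet.1 hz)))

theorem exists_le_isTProperPrime {A : Ideal D} (hA : ¬ InTClosure A 1) :
    ∃ P : Ideal D, IsTProperPrime P ∧ A ≤ P := by
  obtain ⟨P, hAP, hP⟩ := zorn_le_nonempty₀ {B : Ideal D | ¬ InTClosure B 1} (by
    intro c hc hchain B hB
    refine ⟨sSup c, ?_, fun z hz => le_sSup hz⟩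
    rintro ⟨F, hF, hF0, hle, hv⟩
    obtain ⟨B', hB', hFB'⟩ := (Submodule.fg_iff_compact F).1 hF c _
      ⟨B, hB⟩ hchain.directedOn (isLUB_sSup c) hle
    exact hc hB' ⟨F, hF, hF0, hFB', hv⟩) A hA
  refine ⟨P, ⟨?_, hP.prop⟩, hAP⟩
  have hsup : ∀ x, x ∉ P → InTClosure (P ⊔ Ideal.span {x}) 1 := by
    intro x hx
    by_contra hcon
    exact hx (hP.le_of_ge hcon le_sup_left
      (Ideal.mem_sup_right (Ideal.mem_span_singleton_self x)))
  constructor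
  · rintro rfl
    exact hP.prop (inTClosure_of_mem top_ne_bot Submodule.mem_top)
  · intro x y hxy
    by_contra! hcon
    obtain ⟨F, hF, hF0, hFle, hFv⟩ := hsup x hcon.1
    obtain ⟨G, hG, hG0, hGle, hGv⟩ := hsup y hcon.2
    refine hP.prop ⟨F * G, hF.mul hG, mul_ne_zero hF0 hG0, ?_, ?_⟩
    · refine (Ideal.mul_mono hFle hGle).trans ?_
      rw [Ideal.sup_mul, Ideal.mul_sup]
      refine sup_le (sup_le Ideal.mul_le_left Ideal.mul_le_left) ?_
      rw [Ideal.mul_sup, Ideal.span_singleton_mul_span_singleton]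
      exact sup_le Ideal.mul_le_right ((Ideal.span_singleton_le_iff_mem P).2 hxy)
    · intro b c hc h
      refine hFv b c hc fun f hf => ?_
      rw [← mul_one (b * f)]
      refine hGv (b * f) c hc fun g hg => ?_
      rw [mul_assoc]
      exact h _ (Ideal.mul_mem_mul hf hg)

theorem inTClosure_of_forall_prime {J : Ideal D} (hJ : J ≠ ⊥) {x : D}
    (h : ∀ P : Ideal D, IsTProperPrime P → ∃ s, s ∉ P ∧ s * x ∈ J) : InTClosure J x := by
  by_cases hx : x = 0
  · exact inTClosure_of_mem hJ (hx ▸ J.zero_mem)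
  by_cases hA : InTClosure (Submodule.comap (LinearMap.toSpanSingleton D D x) J) 1
  · obtain ⟨F, hF, hF0, hle, hv⟩ := hA
    refine ⟨F * Ideal.span {x}, hF.mul ⟨{x}, by simp⟩,
      mul_ne_zero hF0 (by simpa using hx), ?_, ?_⟩
    · rw [Ideal.mul_le]
      intro r hr s hs
      obtain ⟨t, rfl⟩ := Ideal.mem_span_singleton'.1 hs
      have := J.mul_mem_left t (hle hr)
      simp only [LinearMap.toSpanSingleton_apply, smul_eq_mul] at this
      convert this using 1
      ring
    · intro b c hc hdvd
      rw [← mul_one (b * x)]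
      refine hv _ c hc fun f hf => ?_
      rw [mul_right_comm, mul_assoc]
      exact hdvd _ (Ideal.mul_mem_mul hf (Ideal.mem_span_singleton_self x))
  · obtain ⟨P, hP, hle⟩ := exists_le_isTProperPrime hA
    obtain ⟨s, hs, hsx⟩ := h P hP
    exact absurd (hle (by simpa using hsx)) hs

theorem exists_mul_eq_notMem (hD : IsPvMD D) {P : Ideal D} (hP : IsTProperPrime P)
    {F : Ideal D} (hF : F.FG) (hF0 : F ≠ ⊥) :
    ∃ g ∈ F, ∃ b c s : D, c ≠ 0 ∧ (∀ f ∈ F, c ∣ b * f) ∧ b * g = c * s ∧ s ∉ P := by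
  by_contra! hcon
  have hle : coeI D F * (1 / coeI D F) ≤ coeI D P := by
    rw [Submodule.mul_le]
    intro m hm y hy
    obtain ⟨g, hg, rfl⟩ := mem_coeI.1 hm
    obtain ⟨b, c, hc, rfl⟩ := IsFractionRing.div_surjective (A := D) y
    have hc0 : c ≠ 0 := nonZeroDivisors.ne_zero hc
    have hc' : algebraMap D (FractionRing D) c ≠ 0 := by
      simpa using hc0
    have hdvd := (div_mem_one_div_coeI hc0).1 hy
    obtain ⟨s, hs⟩ := hdvd g hg
    refine mem_coeI.2 ⟨s, hcon g hg b c s hc0 hdvd hs, ?_⟩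
    rw [mul_div_assoc', mul_comm, ← map_mul, hs, map_mul]
    field_simp
  have h1 : (1 : FractionRing D) ∈ tSet D (coeI D F * (1 / coeI D F)) := by
    rw [hD F hF0 hF]
    exact Submodule.one_le.1 le_rfl
  obtain ⟨G, hG, hG0, hGle, hGv⟩ :=
    (mem_tSet_of_le_one (hle.trans (coeI_le_one P))).1 h1
  rw [← map_one (algebraMap D (FractionRing D)), algebraMap_mem_vSub] at hGv
  exact hP.2 ⟨G, hG, hG0, coeI_mono.1 (hGle.trans hle), hGv⟩

theorem inTClosure_iff_forall_prime (hD : IsPvMD D) {J : Ideal D} (hJ : J ≠ ⊥) {x : D} :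
    InTClosure J x ↔ ∀ P : Ideal D, IsTProperPrime P → ∃ s, s ∉ P ∧ s * x ∈ J := by
  refine ⟨?_, inTClosure_of_forall_prime hJ⟩
  rintro ⟨F, hF, hF0, hle, hv⟩ P hP
  obtain ⟨g, hg, b, c, s, hc, hdvd, hbg, hs⟩ := exists_mul_eq_notMem hD hP hF hF0
  refine ⟨s, hs, ?_⟩
  obtain ⟨d, hd⟩ := hv b c hc hdvd
  have : s * x = d * g := mul_left_cancel₀ hc (by linear_combination (-x) * hbg + g * hd)
  rw [this]
  exact J.mul_mem_left d (hle hg)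

theorem exists_mul_eq_mul_or (hD : IsPvMD D) {P : Ideal D} (hP : IsTProperPrime P) (x y : D) :
    ∃ s r, s ∉ P ∧ (s * x = r * y ∨ s * y = r * x) := by
  by_cases hx : x = 0
  · exact ⟨1, 0, (Ideal.ne_top_iff_one P).1 hP.1.ne_top, Or.inl (by simp [hx])⟩
  obtain ⟨g, hg, b, c, s, hc, hdvd, hbg, hs⟩ := exists_mul_eq_notMem hD hP
    (F := Ideal.span {x, y}) (Submodule.fg_span (Set.toFinite _))
    (fun h => hx (by
      have : x ∈ (⊥ : Ideal D) := h ▸ Ideal.subset_span (by simp)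
      simpa using this))
  obtain ⟨d, hd⟩ := hdvd x (Ideal.subset_span (by simp))
  obtain ⟨e, he⟩ := hdvd y (Ideal.subset_span (by simp))
  obtain ⟨u, v, rfl⟩ := Ideal.mem_span_pair.1 hg
  have hsum : s = u * d + v * e :=
    mul_left_cancel₀ hc (by linear_combination u * hd + v * he - hbg)
  by_cases hdP : d ∈ P
  · refine ⟨e, d, fun heP => hs ?_, Or.inl (mul_left_cancel₀ hc ?_)⟩
    · rw [hsum]
      exact P.add_mem (P.mul_mem_left u hdP) (P.mul_mem_left v heP)
    · linear_combination y * hd - x * he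
  · refine ⟨d, e, hdP, Or.inr (mul_left_cancel₀ hc ?_)⟩
    linear_combination x * he - y * hd

theorem exists_sq_dvd_mul (hD : IsPvMD D) {P : Ideal D} (hP : IsTProperPrime P) {J : Ideal D}
    {z : D} (hz : z ∈ J * J) : ∃ a ∈ J, ∃ s, s ∉ P ∧ a ^ 2 ∣ s * z := by
  have := hP.1
  refine Submodule.mul_induction_on hz ?_ ?_
  · intro a ha b hb
    obtain ⟨s, r, hs, h | h⟩ := exists_mul_eq_mul_or hD hP a b
    · exact ⟨b, hb, s, hs, r, by linear_combination b * h⟩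
    · exact ⟨a, ha, s, hs, r, by linear_combination a * h⟩
  · rintro x y ⟨a, ha, s, hs, d, hd⟩ ⟨b, hb, t, ht, e, he⟩
    obtain ⟨u, r, hu, h | h⟩ := exists_mul_eq_mul_or hD hP a b
    · refine ⟨b, hb, u ^ 2 * s * t, P.primeCompl.mul_mem
        (P.primeCompl.mul_mem (P.primeCompl.pow_mem hu 2) hs) ht,
        t * r ^ 2 * d + u ^ 2 * s * e, ?_⟩
      linear_combination u ^ 2 * t * hd + u ^ 2 * s * he + t * d * (u * a + r * b) * h
    · refine ⟨a, ha, u ^ 2 * s * t, P.primeCompl.mul_mem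
        (P.primeCompl.mul_mem (P.primeCompl.pow_mem hu 2) hs) ht,
        s * r ^ 2 * e + u ^ 2 * t * d, ?_⟩
      linear_combination u ^ 2 * t * hd + u ^ 2 * s * he + s * e * (u * b + r * a) * h

/-- If `P ⊆ Q` are primes with `D_Q` a valuation ring, then `P D_Q = P D_P`. -/
theorem exists_mul_eq_mul_of_notMem (hD : IsPvMD D) {P Q : Ideal D} [P.IsPrime]
    (hQ : IsTProperPrime Q) (hPQ : P ≤ Q) {a s : D} (ha : a ∈ P) (hs : s ∉ P) :
    ∃ t, t ∉ Q ∧ ∃ r ∈ P, t * a = r * s := by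
  obtain ⟨t, r, ht, h | h⟩ := exists_mul_eq_mul_or hD hQ a s
  · refine ⟨t, ht, r, ?_, h⟩
    exact ((Ideal.IsPrime.mem_or_mem ‹_› (h ▸ P.mul_mem_left t ha)).resolve_right hs)
  · exact absurd (h ▸ P.mul_mem_left r ha) (P.primeCompl.mul_mem (fun h' => ht (hPQ h')) hs)

theorem exists_mul_mem_sq_of_le (hD : IsPvMD D) {P Q : Ideal D} [P.IsPrime]
    (hQ : IsTProperPrime Q) (hPQ : P ≤ Q) {x s : D} (hs : s ∉ P) (hsx : s * x ∈ P * P) :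
    ∃ t, t ∉ Q ∧ t * x ∈ P * P := by
  have := hQ.1
  obtain ⟨a, ha, u, hu, d, hd⟩ := exists_sq_dvd_mul hD hQ hsx
  obtain ⟨t, ht, r, hr, h⟩ := exists_mul_eq_mul_of_notMem hD hQ hPQ ha hs
  refine ⟨t * u, Q.primeCompl.mul_mem ht hu, ?_⟩
  have hs0 : s ≠ 0 := fun h0 => hs (h0 ▸ P.zero_mem)
  have : t * u * x = d * (r * a) :=
    mul_left_cancel₀ hs0 (by linear_combination t * hd + a * d * h)
  rw [this]
  exact Ideal.mul_mem_left _ d (Ideal.mul_mem_mul hr ha)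

omit [IsDomain D] in
theorem exists_notMem_mul_mem_of_minimalPrimes {I P : Ideal D} (hI : I.radical = I)
    (hP : P ∈ I.minimalPrimes) {x : D} (hx : x ∈ P) : ∃ s, s ∉ P ∧ s * x ∈ I := by
  have hprime : P.IsPrime := hP.1.1
  have h : algebraMap D (Localization.AtPrime P) x ∈
      (I.map (algebraMap D (Localization.AtPrime P))).radical := by
    rw [IsLocalization.AtPrime.radical_map_of_mem_minimalPrimes _ P I hP]
    exact Ideal.mem_map_of_mem _ hx
  obtain ⟨n, hn⟩ := h
  rw [← map_pow, IsLocalization.algebraMap_mem_map_algebraMap_iff P.primeCompl] at hn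
  obtain ⟨s, hs, hsx⟩ := hn
  refine ⟨s, hs, hI ▸ ⟨n + 1, ?_⟩⟩
  have : (s * x) ^ (n + 1) = s ^ n * x * (s * x ^ n) := by ring
  rw [this]
  exact I.mul_mem_left _ hsx

omit [IsDomain D] in
theorem exists_notMem_forall_mul_mem {I P F : Ideal D} [P.IsPrime] (hF : F.FG)
    (h : ∀ x ∈ F, ∃ s, s ∉ P ∧ s * x ∈ I) : ∃ s, s ∉ P ∧ ∀ x ∈ F, s * x ∈ I := by
  obtain ⟨S, rfl⟩ := hF
  choose! σ hσ hσI using h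
  refine ⟨∏ i ∈ S, σ i, P.primeCompl.prod_mem fun i hi => hσ i (Ideal.subset_span hi), ?_⟩
  intro x hx
  induction hx using Submodule.span_induction with
  | mem y hy =>
    obtain ⟨d, hd⟩ := Finset.dvd_prod_of_mem σ hy
    rw [hd, mul_right_comm]
    exact I.mul_mem_right _ (hσI y (Ideal.subset_span hy))
  | zero => simp
  | add y z _ _ hy hz => rw [mul_add]; exact I.add_mem hy hz
  | smul r y _ hy => rw [smul_eq_mul, mul_left_comm]; exact I.mul_mem_left r hy

theorem isTIdeal_of_mem_minimalPrimes {I P : Ideal D} (hI0 : I ≠ ⊥) (hIt : IsTIdeal D I)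
    (hI : I.radical = I) (hP : P ∈ I.minimalPrimes) : IsTIdeal D P := by
  have hprime : P.IsPrime := hP.1.1
  have hP0 : P ≠ ⊥ := fun h => hI0 (le_bot_iff.1 (h ▸ hP.1.2))
  rw [isTIdeal_iff hP0]
  rintro x ⟨F, hF, hF0, hle, hv⟩
  obtain ⟨s, hs, hsF⟩ := exists_notMem_forall_mul_mem hF fun y hy =>
    exists_notMem_mul_mem_of_minimalPrimes hI hP (hle hy)
  have hs0 : s ≠ 0 := fun h0 => hs (h0 ▸ P.zero_mem)
  have hsx : s * x ∈ I := by
    refine (isTIdeal_iff hI0).1 hIt _ ⟨Ideal.span {s} * F, Submodule.FG.mul ⟨{s}, by simp⟩ hF,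
      mul_ne_zero (by simpa using hs0) hF0, ?_, ?_⟩
    · rw [Ideal.span_singleton_mul_le_iff]
      exact hsF
    · intro b c hc hdvd
      rw [← mul_assoc]
      refine hv _ c hc fun f hf => ?_
      rw [mul_assoc]
      exact hdvd _ (Ideal.mul_mem_mul (Ideal.mem_span_singleton_self s) hf)
  exact (hprime.mem_or_mem (hP.1.2 hsx)).resolve_left hs

/-- The contraction of `P² D_P` to `D`. -/
def symbolicSquare (P : Ideal D) [P.IsPrime] : Ideal D where
  carrier := {x | ∃ s, s ∉ P ∧ s * x ∈ P * P}
  zero_mem' := ⟨1, (Ideal.ne_top_iff_one P).1 (Ideal.IsPrime.ne_top ‹_›), by simp⟩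
  add_mem' := by
    rintro x y ⟨s, hs, hx⟩ ⟨t, ht, hy⟩
    refine ⟨s * t, P.primeCompl.mul_mem hs ht, ?_⟩
    rw [mul_add, mul_right_comm, mul_assoc s t y]
    exact add_mem (Ideal.mul_mem_right _ _ hx) (Ideal.mul_mem_left _ _ hy)
  smul_mem' := by
    rintro r x ⟨s, hs, hx⟩
    exact ⟨s, hs, by rw [smul_eq_mul, mul_left_comm]; exact Ideal.mul_mem_left _ r hx⟩

omit [IsDomain D] in
theorem mem_symbolicSquare {P : Ideal D} [P.IsPrime] {x : D} :
    x ∈ symbolicSquare P ↔ ∃ s, s ∉ P ∧ s * x ∈ P * P := Iff.rfl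

omit [IsDomain D] in
theorem symbolicSquare_le (P : Ideal D) [P.IsPrime] : symbolicSquare P ≤ P := by
  rintro x ⟨s, hs, hx⟩
  exact (Ideal.IsPrime.mem_or_mem ‹_› (Ideal.mul_le_left hx)).resolve_left hs

omit [IsDomain D] in
theorem sq_mem_symbolicSquare {P : Ideal D} [P.IsPrime] {x : D} (hx : x ∈ P) :
    x ^ 2 ∈ symbolicSquare P :=
  ⟨1, (Ideal.ne_top_iff_one P).1 (Ideal.IsPrime.ne_top ‹_›), by
    rw [one_mul, sq]; exact Ideal.mul_mem_mul hx hx⟩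

theorem symbolicSquare_eq_of_not_isBranched {P : Ideal D} [P.IsPrime] (h : ¬ IsBranched D P) :
    symbolicSquare P = P := by
  by_contra hne
  refine h ⟨symbolicSquare P, ?_, ?_, hne⟩
  · rw [Ideal.isPrimary_iff]
    refine ⟨fun htop => Ideal.IsPrime.ne_top ‹_› (top_le_iff.1 (htop ▸ symbolicSquare_le P)), ?_⟩
    rintro x y ⟨s, hs, hxy⟩
    by_cases hy : y ∈ P
    · exact Or.inr ⟨2, sq_mem_symbolicSquare hy⟩
    · refine Or.inl ⟨s * y, P.primeCompl.mul_mem hs hy, ?_⟩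
      rwa [mul_assoc, mul_comm y x]
  · refine le_antisymm ?_ fun x hx => ⟨2, sq_mem_symbolicSquare hx⟩
    exact (Ideal.IsPrime.radical_le_iff ‹_›).2 (symbolicSquare_le P)

theorem radical_eq_of_tIdem (hD : IsPvMD D) {I : Ideal D} (hI0 : I ≠ ⊥) (hIt : IsTIdeal D I)
    (hI : TIdem D I) : I.radical = I := by
  rw [Ideal.radical_eq_iff]
  refine (Ideal.isRadical_iff_pow_one_lt 2 one_lt_two).2 fun x hx => ?_
  rw [isTIdeal_iff hI0] at hIt
  refine hIt x (inTClosure_of_forall_prime hI0 fun P hP => ?_)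
  have := hP.1
  by_cases hx0 : x = 0
  · exact ⟨1, (Ideal.ne_top_iff_one P).1 hP.1.ne_top, by simp [hx0]⟩
  obtain ⟨s, hs, hsx⟩ := (inTClosure_iff_forall_prime hD (mul_ne_zero hI0 hI0)).1
    ((tIdem_iff hI0 ((isTIdeal_iff hI0).2 hIt)).1 hI _ hx) P hP
  obtain ⟨a, ha, t, ht, d, hd⟩ := exists_sq_dvd_mul hD hP hsx
  obtain ⟨u, r, hu, h | h⟩ := exists_mul_eq_mul_or hD hP x a
  · exact ⟨u, hu, h ▸ I.mul_mem_left r ha⟩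
  · have hr : u ^ 2 * (t * s) = r ^ 2 * d :=
      mul_right_cancel₀ (pow_ne_zero 2 hx0)
        (by linear_combination u ^ 2 * hd + d * (u * a + r * x) * h)
    have hrP : r ∉ P := fun hrP => P.primeCompl.mul_mem (P.primeCompl.pow_mem hu 2)
      (P.primeCompl.mul_mem ht hs) (hr ▸ P.mul_mem_right d (P.pow_mem_of_mem hrP 2 two_pos))
    exact ⟨r, hrP, h ▸ I.mul_mem_left u ha⟩

theorem tIdem_of_mem_minimalPrimes (hD : IsPvMD D) {I P : Ideal D} (hI0 : I ≠ ⊥)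
    (hIt : IsTIdeal D I) (hI : TIdem D I) (hrad : I.radical = I) (hP : P ∈ I.minimalPrimes) :
    TIdem D P := by
  have hprime : P.IsPrime := hP.1.1
  have hP0 : P ≠ ⊥ := fun h => hI0 (le_bot_iff.1 (h ▸ hP.1.2))
  have hPt := isTIdeal_of_mem_minimalPrimes hI0 hIt hrad hP
  have hPprop : IsTProperPrime P := ⟨hprime, fun h =>
    hprime.ne_top ((Ideal.eq_top_iff_one P).2 ((isTIdeal_iff hP0).1 hPt 1 h))⟩
  rw [tIdem_iff hP0 hPt]
  intro x hx
  refine inTClosure_of_forall_prime (mul_ne_zero hP0 hP0) fun Q hQ => ?_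
  by_cases hPQ : P ≤ Q
  · obtain ⟨s, hs, hsx⟩ := exists_notMem_mul_mem_of_minimalPrimes hrad hP hx
    obtain ⟨t, ht, htx⟩ := (inTClosure_iff_forall_prime hD (mul_ne_zero hI0 hI0)).1
      ((tIdem_iff hI0 hIt).1 hI _ hsx) P hPprop
    refine exists_mul_mem_sq_of_le hD hQ hPQ (P.primeCompl.mul_mem ht hs) ?_
    rw [mul_assoc]
    exact Ideal.mul_mono hP.1.2 hP.1.2 htx
  · obtain ⟨s, hs, hsQ⟩ := SetLike.not_le_iff_exists.1 hPQ
    exact ⟨s, hsQ, Ideal.mul_mem_mul hs hx⟩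

theorem tIdem_of_radical_of_not_isBranched (hD : IsPvMD D) {I : Ideal D} (hI0 : I ≠ ⊥)
    (hIt : IsTIdeal D I) (hrad : I.radical = I)
    (hunbr : ∀ P ∈ I.minimalPrimes, ¬ IsBranched D P) : TIdem D I := by
  rw [tIdem_iff hI0 hIt]
  intro x hx
  refine inTClosure_of_forall_prime (mul_ne_zero hI0 hI0) fun Q hQ => ?_
  have hQprime := hQ.1
  by_cases hIQ : I ≤ Q
  · obtain ⟨P, hP, hPQ⟩ := Ideal.exists_minimalPrimes_le hIQ
    have hprime : P.IsPrime := hP.1.1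
    have hxP : x ∈ symbolicSquare P :=
      (symbolicSquare_eq_of_not_isBranched (hunbr P hP)).symm ▸ hP.1.2 hx
    obtain ⟨s, hs, hsx⟩ := mem_symbolicSquare.1 hxP
    obtain ⟨t, ht, htx⟩ := exists_mul_mem_sq_of_le hD hQ hPQ hs hsx
    obtain ⟨a, ha, u, hu, d, hd⟩ := exists_sq_dvd_mul hD hQ htx
    obtain ⟨v, hv, hva⟩ := exists_notMem_mul_mem_of_minimalPrimes hrad hP ha
    obtain ⟨w, hw, r, hr, h⟩ := exists_mul_eq_mul_of_notMem hD hQ hPQ ha hv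
    have hwa : w * a ∈ I := by
      rw [← hrad]
      refine ⟨2, ?_⟩
      have : (w * a) ^ 2 = w * r * (v * a) := by linear_combination w * a * h
      rw [this]
      exact I.mul_mem_left _ hva
    refine ⟨w * w * (u * t), Q.primeCompl.mul_mem (Q.primeCompl.mul_mem hw hw)
      (Q.primeCompl.mul_mem hu ht), ?_⟩
    have : w * w * (u * t) * x = d * ((w * a) * (w * a)) := by linear_combination w * w * hd
    rw [this]
    exact Ideal.mul_mem_left _ d (Ideal.mul_mem_mul hwa hwa)
  · obtain ⟨s, hs, hsQ⟩ := SetLike.not_le_iff_exists.1 hIQ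
    exact ⟨s, hsQ, Ideal.mul_mem_mul hs hx⟩

end TClosure

theorem statement14 (D : Type*) [CommRing D] [IsDomain D]
    (hPvMD : IsPvMD D)
    (hdisc : ∀ P : Ideal D, P.IsPrime → P ≠ ⊥ → IsTIdeal D P → IsBranched D P →
      ¬ TIdem D P)
    (I : Ideal D) (hI0 : I ≠ ⊥) (hIt : IsTIdeal D I) :
    TIdem D I ↔ I.radical = I ∧ ∀ P ∈ I.minimalPrimes, ¬ IsBranched D P := by
  constructor
  · intro h
    have hrad := radical_eq_of_tIdem hPvMD hI0 hIt h
    refine ⟨hrad, fun P hP hbr => ?_⟩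
    exact hdisc P hP.1.1 (fun h0 => hI0 (le_bot_iff.1 (h0 ▸ hP.1.2)))
      (isTIdeal_of_mem_minimalPrimes hI0 hIt hrad hP) hbr
      (tIdem_of_mem_minimalPrimes hPvMD hI0 hIt h hrad hP)
  · rintro ⟨hrad, hunbr⟩
    exact tIdem_of_radical_of_not_isBranched hPvMD hI0 hIt hrad hunbr

end
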